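/- Let Assumption W* hold and let Assumption B̲_{{α_n}} hold for a sequence α_n ↑ 1. Define U_m(x) := inf_{n≥m} u_{α_n}(x), u̲_m(x) := liminf_{y→x} U_m(y) (lower limit along the neighborhood filter of x), and u(x) := liminf_{n→∞, y→x} u_{α_n}(y). Then for every ε > 0 there exists n₀ ∈ ℕ such that for all m ≥ n₀ and all x ∈ X: w̄_{{α_n}} + ε + u(x) ≥ inf_{a∈A} [ c(x,a) + α_m ∫_X u̲_m(y) q(dy|x,a) ], and the infimum over a ∈ A is attained. -/

import Mathlib

open MeasureTheory ProbabilityTheory Filter Topology Set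
open scoped ENNReal NNReal

noncomputable section

/-- The nonnegative part of an extended real, as an element of `ℝ≥0∞`. -/
def eToENN (x : EReal) : ℝ≥0∞ := if x = ⊤ then ⊤ else ENNReal.ofReal x.toReal

/-- Extended integral of an `EReal`-valued function: positive part minus negative part. -/
def eInt {Y : Type*} [MeasurableSpace Y] (μ : Measure Y) (f : Y → EReal) : EReal :=
  ((∫⁻ y, eToENN (f y) ∂μ : ℝ≥0∞) : EReal) - ((∫⁻ y, eToENN (-(f y)) ∂μ : ℝ≥0∞) : EReal)

/-- Extended sum of an `EReal`-valued series: positive part minus negative part. -/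
def eSum (f : ℕ → EReal) : EReal :=
  ((∑' t, eToENN (f t) : ℝ≥0∞) : EReal) - ((∑' t, eToENN (-(f t)) : ℝ≥0∞) : EReal)

/-- Histories of length `t`: `(X × A) ^ t × X`. -/
abbrev Hist (X A : Type*) (t : ℕ) := (Fin t → X × A) × X

/-- A (randomized, history-dependent) policy: a regular transition probability from
histories to actions, at every time epoch. -/
structure Policy (X A : Type*) [MeasurableSpace X] [MeasurableSpace A] where
  π : ∀ t : ℕ, Kernel (Hist X A t) A
  markov : ∀ t, IsMarkovKernel (π t)

/-- A Markov decision process with state space `X`, action space `A`, one-step cost `c`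
(measurable and bounded below, with values in `(-∞, +∞]`) and transition probability `q`. -/
structure MDP (X A : Type*) [MeasurableSpace X] [MeasurableSpace A] where
  c : X → A → EReal
  q : Kernel (X × A) X
  markov : IsMarkovKernel q
  c_meas : Measurable fun p : X × A => c p.1 p.2
  c_ne_bot : ∃ K : ℝ, ∀ x a, (K : EReal) ≤ c x a

variable {X A : Type*} [MeasurableSpace X] [MeasurableSpace A]

/-- The deterministic policy given by a measurable map `φ : X → A` applied to the current state. -/
def detPolicy (φ : X → A) (hφ : Measurable φ) : Policy X A :=
  ⟨fun t => Kernel.deterministic (fun h : Hist X A t => φ h.2) (hφ.comp measurable_snd),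
   fun _ => by infer_instance⟩

/-- The distribution `P_x^π` of the history `h_t`, constructed recursively
(Ionescu-Tulcea finite-dimensional marginals). -/
def histMeas (M : MDP X A) (p : Policy X A) (x : X) : ∀ t : ℕ, Measure (Hist X A t)
  | 0 => Measure.dirac (Fin.elim0, x)
  | (t + 1) =>
      (histMeas M p x t).bind fun h =>
        ((p.π t) h).bind fun a =>
          (M.q (h.2, a)).map fun x' => (Fin.snoc h.1 (h.2, a), x')

/-- The joint distribution of the state-action pair `(x_t, a_t)` under `P_x^π`. -/
def saMeas (M : MDP X A) (p : Policy X A) (x : X) (t : ℕ) : Measure (X × A) :=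
  (histMeas M p x t).bind fun h => ((p.π t) h).map fun a => (h.2, a)

/-- `E_x^π c(x_t, a_t)`. -/
def expCost (M : MDP X A) (p : Policy X A) (x : X) (t : ℕ) : EReal :=
  eInt (saMeas M p x t) fun sa => M.c sa.1 sa.2

/-- The expected total discounted cost `v_α^π(x) = E_x^π ∑_t α^t c(x_t, a_t)`. -/
def vDisc (M : MDP X A) (α : ℝ) (p : Policy X A) (x : X) : EReal :=
  eSum fun t => ((α ^ t : ℝ) : EReal) * expCost M p x t

/-- The finite-horizon expected total (undiscounted) cost `v_{N,1}^π(x)`. -/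
def vFin (M : MDP X A) (N : ℕ) (p : Policy X A) (x : X) : EReal :=
  ∑ t ∈ Finset.range N, expCost M p x t

/-- The discounted value function `v_α(x) = inf_π v_α^π(x)`. -/
def vDiscOpt (M : MDP X A) (α : ℝ) (x : X) : EReal :=
  ⨅ p : Policy X A, vDisc M α p x

/-- The average cost per unit time `w^π(x)`. -/
def avgCost (M : MDP X A) (p : Policy X A) (x : X) : EReal :=
  Filter.limsup (fun N : ℕ => (((N : ℝ)⁻¹ : ℝ) : EReal) * vFin M N p x) atTop

/-- The optimal average cost `w(x) = inf_π w^π(x)`. -/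
def avgOpt (M : MDP X A) (x : X) : EReal :=
  ⨅ p : Policy X A, avgCost M p x

/-- `w* = inf_x w(x)`. -/
def wStar (M : MDP X A) : EReal := ⨅ x : X, avgOpt M x

/-- `m_α = inf_x v_α(x)`. -/
def mDisc (M : MDP X A) (α : ℝ) : EReal := ⨅ x : X, vDiscOpt M α x

/-- The discounted relative value function `u_α(x) = v_α(x) - m_α`. -/
def uDisc (M : MDP X A) (α : ℝ) (x : X) : EReal := vDiscOpt M α x - mDisc M α

/-- `w̄ = limsup_{α↑1} (1-α) m_α`. -/
def wBar (M : MDP X A) : EReal :=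
  Filter.limsup (fun α : ℝ => ((1 - α : ℝ) : EReal) * mDisc M α) (𝓝[Set.Ico (0:ℝ) 1] 1)

/-- `w̲ = liminf_{α↑1} (1-α) m_α`. -/
def wLow (M : MDP X A) : EReal :=
  Filter.liminf (fun α : ℝ => ((1 - α : ℝ) : EReal) * mDisc M α) (𝓝[Set.Ico (0:ℝ) 1] 1)

/-- `w̄_{{α_n}} = limsup_n (1-α_n) m_{α_n}`. -/
def wBarSeq (M : MDP X A) (a : ℕ → ℝ) : EReal :=
  Filter.limsup (fun n : ℕ => ((1 - a n : ℝ) : EReal) * mDisc M (a n)) atTop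

/-- `w̲_{{α_n}} = liminf_n (1-α_n) m_{α_n}`. -/
def wLowSeq (M : MDP X A) (a : ℕ → ℝ) : EReal :=
  Filter.liminf (fun n : ℕ => ((1 - a n : ℝ) : EReal) * mDisc M (a n)) atTop

section TopologicalAssumptions

variable {X A : Type*} [MetricSpace X] [TopologicalSpace.SeparableSpace X]
  [MeasurableSpace X] [BorelSpace X] [StandardBorelSpace X]
  [MetricSpace A] [TopologicalSpace.SeparableSpace A]
  [MeasurableSpace A] [BorelSpace A] [StandardBorelSpace A]

/-- Assumption W*(i): the cost `c` is `K`-inf-compact, i.e., for every nonempty compact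
`K ⊆ X`, the restriction of `c` to `K × A` has compact sublevel sets. -/
def AssumptionWi (M : MDP X A) : Prop :=
  ∀ K : Set X, K.Nonempty → IsCompact K →
    ∀ lam : ℝ, IsCompact {p : X × A | p.1 ∈ K ∧ M.c p.1 p.2 ≤ (lam : EReal)}

/-- Assumption W*(ii): the transition probability `q(·|x,a)` is weakly continuous in `(x,a)`. -/
def AssumptionWii (M : MDP X A) : Prop :=
  ∀ f : BoundedContinuousFunction X ℝ, Continuous fun p : X × A => ∫ y, f y ∂ (M.q p)

/-- Assumption S*(i): for each `x`, the function `a ↦ c(x,a)` has compact sublevel sets. -/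
def AssumptionSi (M : MDP X A) : Prop :=
  ∀ x : X, ∀ lam : ℝ, IsCompact {a : A | M.c x a ≤ (lam : EReal)}

/-- Assumption S*(ii): for each `x`, the transition probability `q(·|x,a)` is setwise
continuous in `a`. -/
def AssumptionSii (M : MDP X A) : Prop :=
  ∀ x : X, ∀ B : Set X, MeasurableSet B → Continuous fun a : A => M.q (x, a) B

end TopologicalAssumptions

section Statements

variable {X A : Type*} [MetricSpace X] [TopologicalSpace.SeparableSpace X]
  [MeasurableSpace X] [BorelSpace X] [StandardBorelSpace X]
  [MetricSpace A] [TopologicalSpace.SeparableSpace A]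
  [MeasurableSpace A] [BorelSpace A] [StandardBorelSpace A]

/-- `U_m(x) = inf_{n ≥ m} u_{α_n}(x)`. -/
def Useq (M : MDP X A) (a : ℕ → ℝ) (m : ℕ) (y : X) : EReal :=
  ⨅ n ∈ Set.Ici m, uDisc M (a n) y

/-- `u̲_m(x) = liminf_{y → x} U_m(y)`, the lower limit along the neighborhood filter. -/
def uLowSeq (M : MDP X A) (a : ℕ → ℝ) (m : ℕ) (x : X) : EReal :=
  Filter.liminf (fun y : X => Useq M a m y) (𝓝 x)

/-- The function `u(x) = liminf_{n→∞, y→x} u_{α_n}(y)`: the lower limit of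
`(n,y) ↦ u_{α_n}(y)` along the product of `atTop` and the neighborhood filter of `x`. -/
def uEqnOne (M : MDP X A) (a : ℕ → ℝ) (x : X) : EReal :=
  Filter.liminf (fun p : ℕ × X => uDisc M (a p.1) p.2) ((atTop : Filter ℕ) ×ˢ 𝓝 x)

section Helpers

lemma eToENN_eq_toENNReal (x : EReal) : eToENN x = x.toENNReal := rfl

lemma toENNReal_coe_sub_add (g : ℝ≥0∞) (k : ℝ≥0) :
    ((g : EReal) - ((k : ℝ) : EReal)).toENNReal + k
      = g + (-((g : EReal) - ((k : ℝ) : EReal))).toENNReal := by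
  induction g with
  | top => simp
  | coe g =>
    have h1 : ((g : ℝ≥0∞) : EReal) = ((g : ℝ) : EReal) := rfl
    rw [h1, ← EReal.coe_sub, ← EReal.coe_neg, EReal.real_coe_toENNReal,
      EReal.real_coe_toENNReal]
    have hk : (k : ℝ≥0∞) = ENNReal.ofReal k := by simp
    have hg : (g : ℝ≥0∞) = ENNReal.ofReal g := by simp
    rcases le_total (g : ℝ) k with h | h
    · rw [ENNReal.ofReal_of_nonpos (by linarith), hg, hk, ← ENNReal.ofReal_add (by simp) (by linarith)]
      simp
    · rw [ENNReal.ofReal_of_nonpos (p := -((g : ℝ) - k)) (by linarith), hg, hk,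
        ← ENNReal.ofReal_add (by linarith) (by simp)]
      simp

lemma toENNReal_neg_coe_sub_le (g : ℝ≥0∞) (k : ℝ≥0) :
    (-((g : EReal) - ((k : ℝ) : EReal))).toENNReal ≤ k := by
  have h : -((g : EReal) - ((k : ℝ) : EReal)) ≤ ((k : ℝ≥0∞) : EReal) := by
    rw [EReal.neg_sub (Or.inr (EReal.coe_ne_bot _)) (Or.inr (EReal.coe_ne_top _)), add_comm,
      ← sub_eq_add_neg]
    have : ((k : ℝ) : EReal) - g ≤ (k : ℝ) - 0 :=
      EReal.sub_le_sub le_rfl (EReal.coe_ennreal_nonneg g)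
    rwa [sub_zero] at this
  simpa using EReal.toENNReal_le_toENNReal h

/-- The extended integral of `g - k`, where `g ≥ 0` and `k ≥ 0` is finite-valued with finite
integral. -/
lemma eInt_coe_sub {Y : Type*} [MeasurableSpace Y] (μ : Measure Y) {g : Y → ℝ≥0∞} {k : Y → ℝ≥0}
    (hg : Measurable g) (hk : Measurable k) {s : ℝ≥0} (hs : ∫⁻ y, (k y : ℝ≥0∞) ∂μ = s) :
    eInt μ (fun y => (g y : EReal) - ((k y : ℝ) : EReal))
      = ((∫⁻ y, g y ∂μ : ℝ≥0∞) : EReal) - ((s : ℝ) : EReal) := by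
  simp only [eInt, eToENN_eq_toENNReal]
  have h1 := lintegral_congr (μ := μ) fun y => toENNReal_coe_sub_add (g y) (k y)
  rw [lintegral_add_right _ (by fun_prop), lintegral_add_left hg, hs] at h1
  have h2 := lintegral_mono (μ := μ) fun y => toENNReal_neg_coe_sub_le (g y) (k y)
  rw [hs] at h2
  generalize (∫⁻ y, ((g y : EReal) - ((k y : ℝ) : EReal)).toENNReal ∂μ) = P at *
  generalize (∫⁻ y, (-((g y : EReal) - ((k y : ℝ) : EReal))).toENNReal ∂μ) = N at *
  generalize (∫⁻ y, g y ∂μ) = G at *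
  lift N to ℝ≥0 using ne_top_of_le_ne_top ENNReal.coe_ne_top h2
  have hN : ((N : ℝ≥0∞) : EReal) = ((N : ℝ) : EReal) := rfl
  induction G with
  | top =>
    have : P = ⊤ := by simpa using h1
    subst this
    rw [hN]; simp
  | coe G =>
    have hP : P ≠ ⊤ := by
      rintro rfl
      simp [← ENNReal.coe_add] at h1
    lift P to ℝ≥0 using hP
    have h3 : (P : ℝ) + s = G + N := by exact_mod_cast h1
    have hP : ((P : ℝ≥0∞) : EReal) = ((P : ℝ) : EReal) := rfl
    have hG : ((G : ℝ≥0∞) : EReal) = ((G : ℝ) : EReal) := rfl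
    rw [hP, hG, hN, ← EReal.coe_sub, ← EReal.coe_sub]
    congr 1
    linarith

/-- The extended integral of a nonnegative function. -/
lemma eInt_of_nonneg {Y : Type*} [MeasurableSpace Y] (μ : Measure Y) {f : Y → EReal}
    (hf : ∀ y, 0 ≤ f y) :
    eInt μ f = ((∫⁻ y, (f y).toENNReal ∂μ : ℝ≥0∞) : EReal) := by
  have h : ∀ y, (-(f y)).toENNReal = 0 := fun y => by
    rw [EReal.toENNReal_of_nonpos]
    simpa using hf y
  simp [eInt, eToENN_eq_toENNReal, h]

lemma eSum_eq_eInt (f : ℕ → EReal) : eSum f = eInt Measure.count f := by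
  simp [eSum, eInt, lintegral_count]

/-- Lower semicontinuity of integrals along a weakly continuous family of probability measures. -/
lemma lowerSemicontinuous_lintegral_of_weak {Z Y : Type*} [TopologicalSpace Z]
    [FirstCountableTopology Z] [MetricSpace Y] [MeasurableSpace Y] [BorelSpace Y]
    (μ : Z → Measure Y) [∀ z, IsProbabilityMeasure (μ z)]
    (hμ : ∀ f : BoundedContinuousFunction Y ℝ, Continuous fun z => ∫ y, f y ∂(μ z))
    {g : Y → ℝ≥0∞} (hg : LowerSemicontinuous g) :
    LowerSemicontinuous fun z => ∫⁻ y, g y ∂(μ z) := by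
  have hopen : ∀ (z : Z) (G : Set Y), IsOpen G → μ z G ≤ liminf (fun z' => μ z' G) (𝓝 z) := by
    intro z G hG
    let P : Z → ProbabilityMeasure Y := fun z => ⟨μ z, inferInstance⟩
    have hP : Tendsto P (𝓝 z) (𝓝 (P z)) := by
      rw [ProbabilityMeasure.tendsto_iff_forall_integral_tendsto]
      intro f
      exact (hμ f).tendsto z
    exact ProbabilityMeasure.le_liminf_measure_open_of_tendsto hP hG
  have htrunc : ∀ N : ℕ, LowerSemicontinuous fun z => ∫⁻ y, min (g y) (N : ℝ≥0∞) ∂(μ z) := by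
    intro N
    have hlsc : LowerSemicontinuous fun y => min (g y) (N : ℝ≥0∞) :=
      hg.inf lowerSemicontinuous_const
    have hne : ∀ y, min (g y) (N : ℝ≥0∞) ≠ ⊤ := fun y =>
      ne_top_of_le_ne_top (ENNReal.natCast_ne_top N) (min_le_right _ _)
    have hlc : ∀ z, ∫⁻ y, min (g y) (N : ℝ≥0∞) ∂(μ z)
        = ∫⁻ t in Set.Ioi (0 : ℝ), μ z {y | ENNReal.ofReal t < min (g y) (N : ℝ≥0∞)} := by
      intro z
      have h := lintegral_eq_lintegral_meas_lt (μ z)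
        (f := fun y => (min (g y) (N : ℝ≥0∞)).toReal) (Eventually.of_forall fun y => by simp)
        hlsc.measurable.ennreal_toReal.aemeasurable
      simp_rw [ENNReal.ofReal_toReal (hne _)] at h
      rw [h]
      refine setLIntegral_congr_fun measurableSet_Ioi fun t ht => ?_
      congr 1
      ext y
      exact (ENNReal.ofReal_lt_iff_lt_toReal (le_of_lt ht) (hne y)).symm
    rw [lowerSemicontinuous_iff_le_liminf]
    intro z
    simp_rw [hlc]
    refine (lintegral_mono fun t => hopen z _ (hlsc.isOpen_preimage _)).trans ?_
    refine lintegral_liminf_le' fun z' => Antitone.measurable (fun s t hst => ?_) |>.aemeasurable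
    exact measure_mono fun y hy => lt_of_le_of_lt (ENNReal.ofReal_le_ofReal hst) hy
  have hsup : ∀ z, ∫⁻ y, g y ∂(μ z) = ⨆ N : ℕ, ∫⁻ y, min (g y) (N : ℝ≥0∞) ∂(μ z) := by
    intro z
    rw [← lintegral_iSup (fun N => hg.measurable.min measurable_const)
      (fun i j hij y => min_le_min_left _ (by exact_mod_cast hij))]
    refine lintegral_congr fun y => ?_
    have h := inf_iSup_eq (g y) (fun N : ℕ => (N : ℝ≥0∞))
    rw [ENNReal.iSup_natCast, inf_top_eq] at h
    exact h
  simp_rw [hsup]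
  exact lowerSemicontinuous_iSup htrunc

/-- A Berge-type theorem: the partial infimum of a function whose sublevel sets over compact sets
are compact is lower semicontinuous. -/
lemma lowerSemicontinuous_iInf_of_infCompact {X A : Type*} [MetricSpace X] [MetricSpace A]
    {f : X × A → ℝ≥0∞}
    (hf : ∀ K : Set X, IsCompact K → ∀ r : ℝ≥0, IsCompact {p : X × A | p.1 ∈ K ∧ f p ≤ r}) :
    LowerSemicontinuous fun x => ⨅ b : A, f (x, b) := by
  intro x r hr
  obtain ⟨s, hrs, hsx⟩ := ENNReal.lt_iff_exists_nnreal_btwn.1 hr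
  by_contra hcon
  have hfreq : ∃ᶠ y in 𝓝 x, ¬ r < ⨅ b : A, f (y, b) := by
    simpa only [Filter.Frequently, not_not] using hcon
  obtain ⟨y, hyx, hy⟩ := exists_seq_forall_of_frequently hfreq
  have hb : ∀ n, ∃ b, f (y n, b) < s := fun n =>
    iInf_lt_iff.1 ((not_lt.1 (hy n)).trans_lt hrs)
  choose b hb using hb
  obtain ⟨p, hp, φ, hφ, hlim⟩ := (hf _ hyx.isCompact_insert_range s).tendsto_subseq
    (x := fun n => (y n, b n)) fun n => ⟨Or.inr ⟨n, rfl⟩, (hb n).le⟩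
  have h1 : Tendsto (fun n => y (φ n)) atTop (𝓝 p.1) := (continuous_fst.tendsto p).comp hlim
  have h2 : p.1 = x := tendsto_nhds_unique h1 (hyx.comp hφ.tendsto_atTop)
  have h3 : (⨅ b : A, f (x, b)) ≤ s := by
    refine (iInf_le _ p.2).trans ?_
    rw [← h2]
    exact hp.2
  exact absurd hsx (not_lt.2 h3)

/-- Attainment of the partial infimum. -/
lemma exists_eq_iInf_of_infCompact {X A : Type*} [MetricSpace X] [MetricSpace A] [Nonempty A]
    {f : X × A → ℝ≥0∞}
    (hf : ∀ K : Set X, IsCompact K → ∀ r : ℝ≥0, IsCompact {p : X × A | p.1 ∈ K ∧ f p ≤ r})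
    (x : X) : ∃ b, f (x, b) = ⨅ b : A, f (x, b) := by
  by_cases htop : (⨅ b : A, f (x, b)) = ⊤
  · obtain ⟨b⟩ := ‹Nonempty A›
    exact ⟨b, by rw [htop]; exact iInf_eq_top.1 htop b⟩
  let ι := {r : ℝ≥0 // (⨅ b : A, f (x, b)) < r}
  let S : ι → Set (X × A) := fun r => {p | p.1 ∈ ({x} : Set X) ∧ f p ≤ (r : ℝ≥0)}
  have hc : ∀ r, IsCompact (S r) := fun r => hf {x} isCompact_singleton r
  have : Nonempty ι := by
    obtain ⟨r, hr, -⟩ := ENNReal.lt_iff_exists_nnreal_btwn.1 (lt_top_iff_ne_top.2 htop)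
    exact ⟨⟨r, hr⟩⟩
  have hne : (⋂ r, S r).Nonempty := by
    refine IsCompact.nonempty_iInter_of_directed_nonempty_isCompact_isClosed S ?_ ?_ hc
      fun r => (hc r).isClosed
    · intro r s
      rcases le_total r.1 s.1 with h | h
      · exact ⟨r, subset_rfl, fun p hp => ⟨hp.1, hp.2.trans (by exact_mod_cast h)⟩⟩
      · exact ⟨s, fun p hp => ⟨hp.1, hp.2.trans (by exact_mod_cast h)⟩, subset_rfl⟩
    · intro r
      obtain ⟨b, hb⟩ := iInf_lt_iff.1 r.2
      exact ⟨(x, b), rfl, hb.le⟩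
  obtain ⟨⟨y, b⟩, hp⟩ := hne
  rw [Set.mem_iInter] at hp
  have hyx : y = x := (hp (Classical.arbitrary ι)).1
  subst hyx
  refine ⟨b, le_antisymm (le_of_forall_gt fun s hs => ?_) (iInf_le _ b)⟩
  obtain ⟨r, hr, hrs⟩ := ENNReal.lt_iff_exists_nnreal_btwn.1 hs
  exact (hp ⟨r, hr⟩).2.trans_lt hrs

/-- A function whose sublevel sets over compact sets are compact is lower semicontinuous. -/
lemma lowerSemicontinuous_of_infCompact {X A : Type*} [MetricSpace X] [MetricSpace A]
    {f : X × A → ℝ≥0∞}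
    (hf : ∀ K : Set X, IsCompact K → ∀ r : ℝ≥0, IsCompact {p : X × A | p.1 ∈ K ∧ f p ≤ r}) :
    LowerSemicontinuous f := by
  rw [lowerSemicontinuous_iff_isClosed_preimage]
  intro r
  induction r with
  | top => simp
  | coe r =>
    refine IsSeqClosed.isClosed fun p q hp hpq => ?_
    have h1 : Tendsto (fun n => (p n).1) atTop (𝓝 q.1) := (continuous_fst.tendsto q).comp hpq
    exact ((hf _ h1.isCompact_insert_range r).isClosed.mem_of_tendsto hpq
      (Eventually.of_forall fun n => ⟨Or.inr ⟨n, rfl⟩, hp n⟩)).2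

/-- Adding a nonnegative lower semicontinuous function preserves compactness of sublevel sets
over compact sets. -/
lemma infCompact_add {X A : Type*} [MetricSpace X] [MetricSpace A]
    {f g : X × A → ℝ≥0∞}
    (hf : ∀ K : Set X, IsCompact K → ∀ r : ℝ≥0, IsCompact {p : X × A | p.1 ∈ K ∧ f p ≤ r})
    (hg : LowerSemicontinuous g) (K : Set X) (hK : IsCompact K) (r : ℝ≥0) :
    IsCompact {p : X × A | p.1 ∈ K ∧ f p + g p ≤ r} := by
  have hclosed : IsClosed ((fun p => f p + g p) ⁻¹' Set.Iic (r : ℝ≥0∞)) :=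
    ((lowerSemicontinuous_of_infCompact hf).add hg).isClosed_preimage _
  convert (hf K hK r).inter_right hclosed using 1
  ext p
  exact ⟨fun h => ⟨⟨h.1, le_self_add.trans h.2⟩, h.2⟩, fun h => ⟨h.1.1, h.2⟩⟩

end Helpers

section Histories

variable {X A : Type*} [MeasurableSpace X] [MeasurableSpace A]

lemma measurable_map_kernel {α β γ : Type*} [MeasurableSpace α] [MeasurableSpace β]
    [MeasurableSpace γ] (κ : Kernel α β) [IsSFiniteKernel κ] {f : α × β → γ} (hf : Measurable f) :
    Measurable fun a => (κ a).map fun b => f (a, b) := by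
  refine Measure.measurable_of_measurable_coe _ fun s hs => ?_
  have h : ∀ a, ((κ a).map fun b => f (a, b)) s = κ a (Prod.mk a ⁻¹' (f ⁻¹' s)) := fun a =>
    Measure.map_apply (hf.comp measurable_prodMk_left) hs
  simp_rw [h]
  exact Kernel.measurable_kernel_prodMk_left (hf hs)

lemma measurable_bind_kernel {α β γ : Type*} [MeasurableSpace α] [MeasurableSpace β]
    [MeasurableSpace γ] (κ : Kernel α β) [IsSFiniteKernel κ] {η : α × β → Measure γ}
    (hη : Measurable η) : Measurable fun a => (κ a).bind fun b => η (a, b) := by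
  refine Measure.measurable_of_measurable_coe _ fun s hs => ?_
  have h : ∀ a, ((κ a).bind fun b => η (a, b)) s = ∫⁻ b, η (a, b) s ∂(κ a) := fun a =>
    Measure.bind_apply hs (hη.comp measurable_prodMk_left).aemeasurable
  simp_rw [h]
  exact ((Measure.measurable_coe hs).comp hη).lintegral_kernel_prod_right'

lemma measurable_hist_snoc {t : ℕ} :
    Measurable fun z : (Hist X A t × A) × X =>
      ((Fin.snoc z.1.1.1 (z.1.1.2, z.1.2), z.2) : Hist X A (t + 1)) := by
  refine Measurable.prodMk (measurable_pi_lambda _ fun i => ?_) measurable_snd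
  induction i using Fin.lastCases with
  | last => simp only [Fin.snoc_last]; fun_prop
  | cast i => simp only [Fin.snoc_castSucc]; fun_prop

lemma measurable_hist_cons {t : ℕ} :
    Measurable fun z : (X × A) × Hist X A t =>
      ((Fin.cons z.1 z.2.1, z.2.2) : Hist X A (t + 1)) := by
  refine Measurable.prodMk (measurable_pi_lambda _ fun i => ?_) (by fun_prop)
  induction i using Fin.cases with
  | zero => simp only [Fin.cons_zero]; fun_prop
  | succ i => simp only [Fin.cons_succ]; fun_prop

variable (M : MDP X A) (p : Policy X A)

lemma lintegral_histMeas_succ (x : X) (t : ℕ) {F : Hist X A (t + 1) → ℝ≥0∞} (hF : Measurable F) :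
    ∫⁻ h, F h ∂(histMeas M p x (t + 1)) =
      ∫⁻ h, ∫⁻ b, ∫⁻ y, F (Fin.snoc h.1 (h.2, b), y) ∂(M.q (h.2, b)) ∂(p.π t h)
        ∂(histMeas M p x t) := by
  have := M.markov
  have := p.markov t
  have h1 : Measurable fun z : Hist X A t × A =>
      (M.q (z.1.2, z.2)).map fun y => ((Fin.snoc z.1.1 (z.1.2, z.2), y) : Hist X A (t + 1)) :=
    measurable_map_kernel (M.q.comap (fun z : Hist X A t × A => (z.1.2, z.2)) (by fun_prop))
      measurable_hist_snoc
  have h2 := measurable_bind_kernel (p.π t) h1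
  rw [histMeas, Measure.lintegral_bind h2.aemeasurable hF.aemeasurable]
  refine lintegral_congr fun h => ?_
  refine (Measure.lintegral_bind (h1.comp measurable_prodMk_left).aemeasurable
    hF.aemeasurable).trans (lintegral_congr fun b => ?_)
  exact lintegral_map hF (measurable_hist_snoc.comp (measurable_prodMk_left (x := (h, b))))

lemma lintegral_saMeas (x : X) (t : ℕ) {F : X × A → ℝ≥0∞} (hF : Measurable F) :
    ∫⁻ s, F s ∂(saMeas M p x t) =
      ∫⁻ h, ∫⁻ b, F (h.2, b) ∂(p.π t h) ∂(histMeas M p x t) := by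
  have := p.markov t
  have h1 : Measurable fun h : Hist X A t => (p.π t h).map fun b => (h.2, b) :=
    measurable_map_kernel (p.π t) (f := fun z : Hist X A t × A => (z.1.2, z.2)) (by fun_prop)
  rw [saMeas, Measure.lintegral_bind h1.aemeasurable hF.aemeasurable]
  exact lintegral_congr fun h => lintegral_map hF measurable_prodMk_left

lemma isProbabilityMeasure_histMeas (x : X) (t : ℕ) :
    IsProbabilityMeasure (histMeas M p x t) := by
  induction t with
  | zero => rw [histMeas]; infer_instance
  | succ t ih =>
    have := M.markov
    have := p.markov t
    constructor
    rw [← lintegral_one, lintegral_histMeas_succ M p x t measurable_const]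
    simp

lemma isProbabilityMeasure_saMeas (x : X) (t : ℕ) :
    IsProbabilityMeasure (saMeas M p x t) := by
  have := p.markov t
  have := isProbabilityMeasure_histMeas M p x t
  constructor
  rw [← lintegral_one, lintegral_saMeas M p x t measurable_const]
  simp

/-- The policy that continues `p` after the first state-action pair `z`. -/
def shiftPolicy (z : X × A) : Policy X A where
  π t := (p.π (t + 1)).comap (fun h : Hist X A t => (Fin.cons z h.1, h.2))
    (measurable_hist_cons.comp measurable_prodMk_left)
  markov t := by
    have := p.markov (t + 1)
    infer_instance

lemma shiftPolicy_apply (z : X × A) (t : ℕ) (h : Hist X A t) :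
    (shiftPolicy p z).π t h = p.π (t + 1) (Fin.cons z h.1, h.2) := rfl

lemma measurable_lintegral_step {Z : Type*} [MeasurableSpace Z]
    (κ : Kernel Z A) [IsMarkovKernel κ] {g : Z → X} (hg : Measurable g)
    {F : (Z × A) × X → ℝ≥0∞} (hF : Measurable F) :
    Measurable fun z => ∫⁻ b, ∫⁻ y, F ((z, b), y) ∂(M.q (g z, b)) ∂(κ z) := by
  have := M.markov
  have h1 : Measurable fun w : Z × A => ∫⁻ y, F (w, y) ∂(M.q (g w.1, w.2)) :=
    hF.lintegral_kernel_prod_right' (κ := M.q.comap (fun w : Z × A => (g w.1, w.2)) (by fun_prop))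
  exact h1.lintegral_kernel_prod_right'

/-- First-step decomposition of the distribution of the history. -/
lemma lintegral_histMeas_shift (x : X) (t : ℕ) {F : Hist X A (t + 1) → ℝ≥0∞}
    (hF : Measurable F) :
    ∫⁻ h, F h ∂(histMeas M p x (t + 1)) =
      ∫⁻ b, ∫⁻ y, ∫⁻ h, F (Fin.cons (x, b) h.1, h.2) ∂(histMeas M (shiftPolicy p (x, b)) y t)
        ∂(M.q (x, b)) ∂(p.π 0 (Fin.elim0, x)) := by
  have := M.markov
  induction t with
  | zero =>
    have := p.markov 0
    rw [lintegral_histMeas_succ M p x 0 hF]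
    have h1 := measurable_lintegral_step M (p.π 0) measurable_snd
      (hF.comp measurable_hist_snoc)
    simp only [Function.comp_def] at h1
    rw [histMeas, lintegral_dirac' _ h1]
    refine lintegral_congr fun b => lintegral_congr fun y => ?_
    have h2 : Measurable fun h : Hist X A 0 => F (Fin.cons (x, b) h.1, h.2) :=
      hF.comp (measurable_hist_cons.comp (measurable_prodMk_left (x := (x, b))))
    rw [histMeas, lintegral_dirac' _ h2]
    congr 2
    ext i
    all_goals
      have : i = 0 := Fin.fin_one_eq_zero i
      subst this
      rfl
  | succ t ih =>
    have := p.markov (t + 1)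
    rw [lintegral_histMeas_succ M p x (t + 1) hF]
    have h1 := measurable_lintegral_step M (p.π (t + 1)) measurable_snd
      (hF.comp measurable_hist_snoc)
    simp only [Function.comp_def] at h1
    rw [ih h1]
    refine lintegral_congr fun b => lintegral_congr fun y => ?_
    have h2 : Measurable fun h : Hist X A (t + 1) => F (Fin.cons (x, b) h.1, h.2) :=
      hF.comp (measurable_hist_cons.comp (measurable_prodMk_left (x := (x, b))))
    rw [lintegral_histMeas_succ M _ y t h2]
    simp only [Fin.cons_snoc_eq_snoc_cons, shiftPolicy_apply]

/-- Joint measurability of integrals against the distribution of the shifted history. -/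
lemma measurable_lintegral_histMeas_shift (x : X) (t : ℕ) {F : A × Hist X A t → ℝ≥0∞}
    (hF : Measurable F) :
    Measurable fun z : A × X =>
      ∫⁻ h, F (z.1, h) ∂(histMeas M (shiftPolicy p (x, z.1)) z.2 t) := by
  have := M.markov
  induction t with
  | zero =>
    have h : ∀ z : A × X, ∫⁻ h, F (z.1, h) ∂(histMeas M (shiftPolicy p (x, z.1)) z.2 0)
        = F (z.1, (Fin.elim0, z.2)) := fun z => by
      have h2 : Measurable fun h => F (z.1, h) := hF.comp measurable_prodMk_left
      rw [histMeas, lintegral_dirac' _ h2]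
    simp_rw [h]
    fun_prop
  | succ t ih =>
    have := p.markov (t + 1)
    have h : ∀ z : A × X, ∫⁻ h, F (z.1, h) ∂(histMeas M (shiftPolicy p (x, z.1)) z.2 (t + 1))
        = _ := fun z => lintegral_histMeas_succ M _ z.2 t (hF.comp measurable_prodMk_left)
    simp_rw [h, shiftPolicy_apply]
    have hm : Measurable fun w : A × Hist X A t =>
        ((Fin.cons (x, w.1) w.2.1, w.2.2) : Hist X A (t + 1)) :=
      measurable_hist_cons.comp (f := fun w : A × Hist X A t => ((x, w.1), w.2)) (by fun_prop)
    refine ih (F := fun w => ∫⁻ b, ∫⁻ y, F (w.1, (Fin.snoc w.2.1 (w.2.2, b), y))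
      ∂(M.q (w.2.2, b)) ∂(p.π (t + 1) (Fin.cons (x, w.1) w.2.1, w.2.2))) ?_
    have hs : Measurable fun v : ((A × Hist X A t) × A) × X =>
        ((Fin.snoc v.1.1.2.1 (v.1.1.2.2, v.1.2), v.2) : Hist X A (t + 1)) :=
      measurable_hist_snoc.comp
        (f := fun v : ((A × Hist X A t) × A) × X => ((v.1.1.2, v.1.2), v.2)) (by fun_prop)
    exact measurable_lintegral_step M ((p.π (t + 1)).comap _ hm)
      (g := fun w => w.2.2) (by fun_prop)
      (F := fun v => F (v.1.1.1, (Fin.snoc v.1.1.2.1 (v.1.1.2.2, v.1.2), v.2)))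
      (hF.comp ((by fun_prop : Measurable fun v : ((A × Hist X A t) × A) × X => v.1.1.1).prodMk hs))

/-- The expected discounted total of a nonnegative cost `C`. -/
def discTotal (C : X × A → ℝ≥0∞) (α : ℝ≥0) (x : X) : ℝ≥0∞ :=
  ∑' t : ℕ, (α : ℝ≥0∞) ^ t * ∫⁻ s, C s ∂(saMeas M p x t)

lemma lintegral_saMeas_zero (x : X) {C : X × A → ℝ≥0∞} (hC : Measurable C) :
    ∫⁻ s, C s ∂(saMeas M p x 0) = ∫⁻ b, C (x, b) ∂(p.π 0 (Fin.elim0, x)) := by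
  have := p.markov 0
  rw [lintegral_saMeas M p x 0 hC, histMeas, lintegral_dirac']
  exact (show Measurable fun z : Hist X A 0 × A => C (z.1.2, z.2) by
    fun_prop).lintegral_kernel_prod_right'

lemma measurable_lintegral_action (t : ℕ) {C : X × A → ℝ≥0∞} (hC : Measurable C) :
    Measurable fun h : Hist X A t => ∫⁻ b, C (h.2, b) ∂(p.π t h) := by
  have := p.markov t
  exact (show Measurable fun z : Hist X A t × A => C (z.1.2, z.2) by
    fun_prop).lintegral_kernel_prod_right'

lemma lintegral_saMeas_succ (x : X) (t : ℕ) {C : X × A → ℝ≥0∞} (hC : Measurable C) :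
    ∫⁻ s, C s ∂(saMeas M p x (t + 1)) =
      ∫⁻ b, ∫⁻ y, ∫⁻ s, C s ∂(saMeas M (shiftPolicy p (x, b)) y t) ∂(M.q (x, b))
        ∂(p.π 0 (Fin.elim0, x)) := by
  rw [lintegral_saMeas M p x (t + 1) hC,
    lintegral_histMeas_shift M p x t (measurable_lintegral_action p (t + 1) hC)]
  refine lintegral_congr fun b => lintegral_congr fun y => ?_
  rw [lintegral_saMeas M _ y t hC]
  rfl

lemma measurable_lintegral_saMeas_shift (x : X) (t : ℕ) {C : X × A → ℝ≥0∞} (hC : Measurable C) :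
    Measurable fun z : A × X => ∫⁻ s, C s ∂(saMeas M (shiftPolicy p (x, z.1)) z.2 t) := by
  simp_rw [lintegral_saMeas M _ _ t hC, shiftPolicy_apply]
  refine measurable_lintegral_histMeas_shift M p x t
    (F := fun w => ∫⁻ b, C (w.2.2, b) ∂(p.π (t + 1) (Fin.cons (x, w.1) w.2.1, w.2.2))) ?_
  exact (measurable_lintegral_action p (t + 1) hC).comp
    (measurable_hist_cons.comp (f := fun w : A × Hist X A t => ((x, w.1), w.2)) (by fun_prop))

/-- First-step decomposition of the discounted total cost. -/
lemma discTotal_eq (x : X) {C : X × A → ℝ≥0∞} (hC : Measurable C) (α : ℝ≥0) :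
    discTotal M p C α x =
      ∫⁻ b, (C (x, b) + α * ∫⁻ y, discTotal M (shiftPolicy p (x, b)) C α y ∂(M.q (x, b)))
        ∂(p.π 0 (Fin.elim0, x)) := by
  have := M.markov
  have hmeas := fun t => measurable_lintegral_saMeas_shift M p x t hC
  have hmeas2 : ∀ t, Measurable fun b : A =>
      ∫⁻ y, ∫⁻ s, C s ∂(saMeas M (shiftPolicy p (x, b)) y t) ∂(M.q (x, b)) := fun t =>
    (hmeas t).lintegral_kernel_prod_right' (κ := M.q.comap (fun b : A => (x, b)) (by fun_prop))
  have hC1 : Measurable fun b => C (x, b) := hC.comp measurable_prodMk_left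
  rw [lintegral_add_left hC1, discTotal, tsum_eq_zero_add' (by simp),
    lintegral_saMeas_zero M p x hC, pow_zero, one_mul]
  congr 1
  simp_rw [lintegral_saMeas_succ M p x _ hC, discTotal]
  have h1 : ∀ b, α * ∫⁻ y, ∑' t : ℕ, (α : ℝ≥0∞) ^ t *
        ∫⁻ s, C s ∂(saMeas M (shiftPolicy p (x, b)) y t) ∂(M.q (x, b))
      = ∑' t : ℕ, (α : ℝ≥0∞) ^ (t + 1) *
        ∫⁻ y, ∫⁻ s, C s ∂(saMeas M (shiftPolicy p (x, b)) y t) ∂(M.q (x, b)) := by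
    intro b
    have hb : ∀ t, Measurable fun y => ∫⁻ s, C s ∂(saMeas M (shiftPolicy p (x, b)) y t) :=
      fun t => by
        have h := (hmeas t).comp (measurable_prodMk_left (x := b))
        simp only [Function.comp_def] at h
        exact h
    have hb' : ∀ t, AEMeasurable (fun y => (α : ℝ≥0∞) ^ t *
        ∫⁻ s, C s ∂(saMeas M (shiftPolicy p (x, b)) y t)) (M.q (x, b)) :=
      fun t => ((hb t).const_mul _).aemeasurable
    rw [lintegral_tsum hb', ← ENNReal.tsum_mul_left]
    refine tsum_congr fun t => ?_
    rw [lintegral_const_mul _ (hb t), pow_succ', mul_assoc]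
  simp_rw [h1]
  have hmeas3 : ∀ t, AEMeasurable (fun b => (α : ℝ≥0∞) ^ (t + 1) *
      ∫⁻ y, ∫⁻ s, C s ∂(saMeas M (shiftPolicy p (x, b)) y t) ∂(M.q (x, b)))
      (p.π 0 (Fin.elim0, x)) := fun t => ((hmeas2 t).const_mul _).aemeasurable
  rw [lintegral_tsum hmeas3]
  exact tsum_congr fun t => (lintegral_const_mul _ (hmeas2 t)).symm

/-- The optimality inequality for the discounted problem. -/
lemma iInf_le_iInf_discTotal {C : X × A → ℝ≥0∞} (hC : Measurable C) (α : ℝ≥0) {g : X → ℝ≥0∞}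
    (hg : ∀ y, g y ≤ ⨅ p, discTotal M p C α y) (x : X) :
    (⨅ b : A, (C (x, b) + α * ∫⁻ y, g y ∂(M.q (x, b)))) ≤ ⨅ p, discTotal M p C α x := by
  refine le_iInf fun p => ?_
  have := p.markov 0
  rw [discTotal_eq M p x hC α]
  calc (⨅ b : A, (C (x, b) + α * ∫⁻ y, g y ∂(M.q (x, b))))
      = ∫⁻ _, (⨅ b : A, (C (x, b) + α * ∫⁻ y, g y ∂(M.q (x, b)))) ∂(p.π 0 (Fin.elim0, x)) := by
        simp
    _ ≤ _ := by
        refine lintegral_mono fun b => (iInf_le _ b).trans ?_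
        gcongr with y
        exact (hg y).trans (iInf_le _ _)

end Histories

section NonnegativeCost

lemma le_coe_ennreal_iInf {ι : Sort*} (f : ι → ℝ≥0∞) {z : EReal} (hz : ∀ i, z ≤ f i) :
    z ≤ ((⨅ i, f i : ℝ≥0∞) : EReal) := by
  have h : z ≤ (z.toENNReal : EReal) := by
    rw [EReal.coe_toENNReal_eq_max]
    exact le_max_right _ _
  refine h.trans (EReal.coe_ennreal_le_coe_ennreal_iff.2 (le_iInf fun i => ?_))
  simpa using EReal.toENNReal_le_toENNReal (hz i)

lemma iInf_coe_ennreal_sub {ι : Sort*} (f : ι → ℝ≥0∞) (s : ℝ) :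
    ⨅ i, ((f i : EReal) - (s : EReal)) = ((⨅ i, f i : ℝ≥0∞) : EReal) - (s : EReal) := by
  refine le_antisymm ?_ (le_iInf fun i => EReal.sub_le_sub
    (EReal.coe_ennreal_le_coe_ennreal_iff.2 (iInf_le _ _)) le_rfl)
  rw [EReal.le_sub_iff_add_le (Or.inl (EReal.coe_ne_bot _)) (Or.inl (EReal.coe_ne_top _))]
  refine le_coe_ennreal_iInf _ fun i => ?_
  rw [← EReal.le_sub_iff_add_le (Or.inl (EReal.coe_ne_bot _)) (Or.inl (EReal.coe_ne_top _))]
  exact iInf_le _ i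

lemma coe_mul_coe_ennreal_sub (α k : ℝ≥0) (E : ℝ≥0∞) :
    ((α : ℝ) : EReal) * ((E : EReal) - ((k : ℝ) : EReal))
      = ((α * E : ℝ≥0∞) : EReal) - (((α * k : ℝ≥0) : ℝ) : EReal) := by
  induction E with
  | top =>
    rcases eq_or_ne α 0 with rfl | h
    · simp
    · have hα : (0 : ℝ) < α := NNReal.coe_pos.2 (pos_iff_ne_zero.2 h)
      rw [ENNReal.mul_top (ENNReal.coe_ne_zero.2 h), EReal.coe_ennreal_top, EReal.top_sub_coe,
        EReal.top_sub_coe, EReal.coe_mul_top_of_pos hα]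
  | coe E =>
    rw [← ENNReal.coe_mul]
    change ((α : ℝ) : EReal) * (((E : ℝ) : EReal) - ((k : ℝ) : EReal))
      = (((α * E : ℝ≥0) : ℝ) : EReal) - (((α * k : ℝ≥0) : ℝ) : EReal)
    rw [← EReal.coe_sub, ← EReal.coe_sub, ← EReal.coe_mul]
    congr 1
    push_cast
    ring

variable {X A : Type*} [MeasurableSpace X] [MeasurableSpace A] (M : MDP X A)

/-- The one-step cost shifted by `k`, as a nonnegative function. -/
def posCost (k : ℝ≥0) (s : X × A) : ℝ≥0∞ := (M.c s.1 s.2 + ((k : ℝ) : EReal)).toENNReal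

lemma measurable_posCost (k : ℝ≥0) : Measurable (posCost M k) :=
  (M.c_meas.add_const _).ereal_toENNReal

variable {M} {k : ℝ≥0} (hk : ∀ x b, ((-(k : ℝ) : ℝ) : EReal) ≤ M.c x b)
include hk

lemma coe_posCost_sub (x : X) (b : A) :
    M.c x b = (posCost M k (x, b) : EReal) - ((k : ℝ) : EReal) := by
  have h : 0 ≤ M.c x b + ((k : ℝ) : EReal) := by
    have := add_le_add_left (hk x b) ((k : ℝ) : EReal)
    rwa [← EReal.coe_add, neg_add_cancel, EReal.coe_zero] at this
  rw [posCost, EReal.coe_toENNReal h, EReal.add_sub_cancel_right]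

lemma expCost_eq (p : Policy X A) (x : X) (t : ℕ) :
    expCost M p x t
      = ((∫⁻ s, posCost M k s ∂(saMeas M p x t) : ℝ≥0∞) : EReal) - ((k : ℝ) : EReal) := by
  have := isProbabilityMeasure_saMeas M p x t
  simp_rw [expCost, coe_posCost_sub hk]
  exact eInt_coe_sub _ (measurable_posCost M k) (k := fun _ => k) measurable_const (by simp)

lemma vDisc_eq {α : ℝ≥0} (hα : α < 1) (p : Policy X A) (x : X) :
    vDisc M α p x
      = (discTotal M p (posCost M k) α x : EReal) - (((k : ℝ) / (1 - α) : ℝ) : EReal) := by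
  have h1 : ∀ t : ℕ, (((α : ℝ) ^ t : ℝ) : EReal) * expCost M p x t
      = (((α : ℝ≥0∞) ^ t * ∫⁻ s, posCost M k s ∂(saMeas M p x t) : ℝ≥0∞) : EReal)
        - (((α ^ t * k : ℝ≥0) : ℝ) : EReal) := fun t => by
    rw [expCost_eq hk, ← NNReal.coe_pow, coe_mul_coe_ennreal_sub, ENNReal.coe_pow]
  have h2 : ∫⁻ t : ℕ, ((α ^ t * k : ℝ≥0) : ℝ≥0∞) ∂Measure.count = ((1 - α)⁻¹ * k : ℝ≥0) := by
    rw [lintegral_count]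
    push_cast
    rw [ENNReal.tsum_mul_right, ENNReal.tsum_geometric, ENNReal.coe_inv (tsub_pos_of_lt hα).ne']
    push_cast
    rfl
  simp_rw [vDisc, h1, eSum_eq_eInt]
  rw [eInt_coe_sub _ (measurable_from_nat) (measurable_from_nat) h2, lintegral_count, discTotal]
  congr 2
  rw [NNReal.coe_mul, NNReal.coe_inv, NNReal.coe_sub hα.le, NNReal.coe_one]
  ring

lemma vDiscOpt_eq {α : ℝ≥0} (hα : α < 1) (x : X) :
    vDiscOpt M α x = ((⨅ p, discTotal M p (posCost M k) α x : ℝ≥0∞) : EReal)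
      - (((k : ℝ) / (1 - α) : ℝ) : EReal) := by
  simp_rw [vDiscOpt, vDisc_eq hk hα]
  exact iInf_coe_ennreal_sub _ _

lemma mDisc_eq {α : ℝ≥0} (hα : α < 1) :
    mDisc M α = ((⨅ x, ⨅ p, discTotal M p (posCost M k) α x : ℝ≥0∞) : EReal)
      - (((k : ℝ) / (1 - α) : ℝ) : EReal) := by
  simp_rw [mDisc, vDiscOpt_eq hk hα]
  exact iInf_coe_ennreal_sub _ _

lemma uDisc_eq {α : ℝ≥0} (hα : α < 1)
    (hfin : ⨅ x, ⨅ p, discTotal M p (posCost M k) α x ≠ ⊤) (x : X) :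
    uDisc M α x = ((⨅ p, discTotal M p (posCost M k) α x)
      - ⨅ x, ⨅ p, discTotal M p (posCost M k) α x : ℝ≥0∞) := by
  rw [uDisc, vDiscOpt_eq hk hα, mDisc_eq hk hα]
  have hle : ⨅ x, ⨅ p, discTotal M p (posCost M k) α x ≤ ⨅ p, discTotal M p (posCost M k) α x :=
    iInf_le (fun x => ⨅ p, discTotal M p (posCost M k) α x) x
  generalize (⨅ p, discTotal M p (posCost M k) α x) = V at *
  generalize (⨅ x, ⨅ p, discTotal M p (posCost M k) α x) = m at *
  generalize (k : ℝ) / (1 - α) = s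
  lift m to ℝ≥0 using hfin
  induction V with
  | top =>
    change (⊤ : EReal) - s - (((m : ℝ) : EReal) - s) = _
    rw [EReal.top_sub_coe, ← EReal.coe_sub, EReal.top_sub_coe, ENNReal.top_sub_coe]
    rfl
  | coe V =>
    rw [← ENNReal.coe_sub]
    change (((V : ℝ) : EReal) - s) - (((m : ℝ) : EReal) - s) = (((V - m : ℝ≥0) : ℝ) : EReal)
    rw [NNReal.coe_sub (by exact_mod_cast hle)]
    simp only [← EReal.coe_sub]
    congr 1
    ring

lemma vFin_eq (N : ℕ) (p : Policy X A) (x : X) :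
    vFin M N p x = ((∑ t ∈ Finset.range N, ∫⁻ s, posCost M k s ∂(saMeas M p x t) : ℝ≥0∞) : EReal)
      - ((N * k : ℝ) : EReal) := by
  induction N with
  | zero => simp [vFin]
  | succ N ih =>
    rw [vFin] at ih ⊢
    rw [Finset.sum_range_succ, Finset.sum_range_succ, ih, expCost_eq hk,
      EReal.coe_ennreal_add]
    have : ((((N + 1 : ℕ) : ℝ) * k : ℝ) : EReal) = ((N * k : ℝ) : EReal) + ((k : ℝ) : EReal) := by
      rw [← EReal.coe_add]
      congr 1
      push_cast
      ring
    rw [this, sub_eq_add_neg, sub_eq_add_neg, sub_eq_add_neg,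
      EReal.neg_add (Or.inl (EReal.coe_ne_bot _)) (Or.inl (EReal.coe_ne_top _)), sub_eq_add_neg]
    exact add_add_add_comm (G := EReal) _ _ _ _

/-- If the optimal average cost is finite somewhere, then the discounted value is finite
somewhere. -/
lemma iInf_discTotal_ne_top (hw : wStar M < ⊤) {α : ℝ≥0} (hα : α < 1) :
    ⨅ x, ⨅ p, discTotal M p (posCost M k) α x ≠ ⊤ := by
  obtain ⟨x, hx⟩ := iInf_lt_iff.1 hw
  obtain ⟨p, hp⟩ := iInf_lt_iff.1 hx
  refine ne_top_of_le_ne_top ?_ ((iInf_le _ x).trans (iInf_le _ p))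
  obtain ⟨r, hr, -⟩ := EReal.lt_iff_exists_real_btwn.1 hp
  obtain ⟨N₀, hN₀⟩ := eventually_atTop.1 (eventually_lt_of_limsup_lt hr)
  let D : ℝ≥0 := (r + k).toNNReal
  have hsum : ∀ N, N₀ + 1 ≤ N →
      ∑ t ∈ Finset.range N, ∫⁻ s, posCost M k s ∂(saMeas M p x t) ≤ ((D * N : ℝ≥0) : ℝ≥0∞) := by
    intro N hN
    have hNpos : (0 : ℝ) < N := by exact_mod_cast (Nat.succ_pos _).trans_le hN
    have h := hN₀ N (by omega)
    rw [vFin_eq hk] at h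
    generalize (∑ t ∈ Finset.range N, ∫⁻ s, posCost M k s ∂(saMeas M p x t)) = S at *
    induction S with
    | top =>
      exfalso
      rw [EReal.coe_ennreal_top, EReal.top_sub_coe,
        EReal.coe_mul_top_of_pos (inv_pos.2 hNpos)] at h
      exact not_top_lt h
    | coe S =>
      change (((N : ℝ)⁻¹ : ℝ) : EReal) * (((S : ℝ) : EReal) - ((N * k : ℝ) : EReal)) < r at h
      rw [← EReal.coe_sub, ← EReal.coe_mul, EReal.coe_lt_coe_iff, inv_mul_lt_iff₀ hNpos] at h
      have h1 : (r + k : ℝ) ≤ D := Real.le_coe_toNNReal _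
      have h2 : (S : ℝ) ≤ D * N := by nlinarith
      exact_mod_cast h2
  have hE : ∀ t : ℕ, ∫⁻ s, posCost M k s ∂(saMeas M p x t)
      ≤ ((D * (t + 1 + N₀ : ℕ) : ℝ≥0) : ℝ≥0∞) := fun t =>
    (Finset.single_le_sum (f := fun t => ∫⁻ s, posCost M k s ∂(saMeas M p x t))
      (fun _ _ => zero_le) (Finset.mem_range.2 (by omega))).trans (hsum (t + 1 + N₀) (by omega))
  have hle : discTotal M p (posCost M k) α x
      ≤ ∑' t : ℕ, ((α ^ t * (D * (t + 1 + N₀ : ℕ)) : ℝ≥0) : ℝ≥0∞) := by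
    refine ENNReal.tsum_le_tsum fun t => ?_
    rw [ENNReal.coe_mul, ENNReal.coe_pow]
    gcongr
    exact hE t
  refine ne_top_of_le_ne_top (ENNReal.tsum_coe_ne_top_iff_summable.2 ?_) hle
  rw [← NNReal.summable_coe]
  have hα' : ‖(α : ℝ)‖ < 1 := by simpa using hα
  have h1 := (summable_pow_mul_geometric_of_norm_lt_one 1 hα').mul_left (D : ℝ)
  have h2 := (summable_geometric_of_norm_lt_one hα').mul_left (D * (1 + N₀) : ℝ)
  refine (h1.add h2).congr fun t => ?_
  push_cast
  ring

end NonnegativeCost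

section AverageCostInequality

variable {X A : Type*} [MeasurableSpace X] [MeasurableSpace A]

lemma lowerSemicontinuous_liminf_nhds {Y : Type*} [TopologicalSpace Y] (f : Y → EReal) :
    LowerSemicontinuous fun x => liminf f (𝓝 x) := by
  intro x r hr
  obtain ⟨z, hrz, hz⟩ := exists_between hr
  filter_upwards [eventually_eventually_nhds.2 (eventually_lt_of_lt_liminf hz)] with y hy
  exact hrz.trans_le (le_liminf_of_le (h := hy.mono fun _ => le_of_lt))

lemma liminf_nhds_le {Y : Type*} [TopologicalSpace Y] (f : Y → EReal) (x : Y) :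
    liminf f (𝓝 x) ≤ f x :=
  liminf_le_of_frequently_le' (Frequently.filter_mono
    (frequently_pure.2 (le_refl (f x)) : ∃ᶠ y in pure x, f y ≤ f x) (pure_le_nhds x))

/-- The right-hand side of the optimality equation, for the shifted one-step cost. -/
def stepValue (M : MDP X A) (k α : ℝ≥0) (G : X → ℝ≥0∞) (s : X × A) : ℝ≥0∞ :=
  posCost M k s + α * ∫⁻ y, G y ∂(M.q s)

variable {M : MDP X A} {k : ℝ≥0}

lemma add_mul_eInt_eq_stepValue (hk : ∀ x b, ((-(k : ℝ) : ℝ) : EReal) ≤ M.c x b) (α : ℝ≥0)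
    {u : X → EReal} (hu : ∀ y, 0 ≤ u y) (x : X) (b : A) :
    M.c x b + ((α : ℝ) : EReal) * eInt (M.q (x, b)) u
      = (stepValue M k α (fun y => (u y).toENNReal) (x, b) : EReal) - ((k : ℝ) : EReal) := by
  rw [coe_posCost_sub hk, eInt_of_nonneg _ hu, stepValue, EReal.coe_ennreal_add,
    EReal.coe_ennreal_mul, sub_eq_add_neg, sub_eq_add_neg, add_right_comm]
  rfl

lemma neg_le_mul_mDisc (hk : ∀ x b, ((-(k : ℝ) : ℝ) : EReal) ≤ M.c x b) (hw : wStar M < ⊤)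
    {α : ℝ≥0} (hα : α < 1) : ((-(k : ℝ) : ℝ) : EReal) ≤ ((1 - α : ℝ) : EReal) * mDisc M α := by
  have hfin := iInf_discTotal_ne_top hk hw hα
  rw [mDisc_eq hk hα]
  generalize (⨅ x, ⨅ p, discTotal M p (posCost M k) α x) = μ at *
  lift μ to ℝ≥0 using hfin
  have hα' : (0 : ℝ) < 1 - α := by simpa using hα
  change _ ≤ ((1 - α : ℝ) : EReal) * (((μ : ℝ) : EReal) - (((k : ℝ) / (1 - α) : ℝ) : EReal))
  rw [← EReal.coe_sub, ← EReal.coe_mul, EReal.coe_le_coe_iff, mul_sub, mul_div_cancel₀ _ hα'.ne']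
  have := mul_nonneg hα'.le μ.coe_nonneg
  linarith

lemma iInf_stepValue_le (hk : ∀ x b, ((-(k : ℝ) : ℝ) : EReal) ≤ M.c x b) (hw : wStar M < ⊤)
    {γ α : ℝ≥0} (hγ : γ ≤ α) (hα : α < 1) {G : X → ℝ≥0∞}
    (hG : ∀ y, (G y : EReal) ≤ uDisc M α y) (x : X) :
    ((⨅ b, stepValue M k γ G (x, b) : ℝ≥0∞) : EReal)
      ≤ ((1 - α : ℝ) : EReal) * mDisc M α + ((k : ℝ) : EReal) + uDisc M α x := by
  have hfin := iInf_discTotal_ne_top hk hw hα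
  simp_rw [uDisc_eq hk hα hfin] at hG ⊢
  rw [mDisc_eq hk hα]
  have hle : ∀ y, ⨅ x, ⨅ p, discTotal M p (posCost M k) α x
      ≤ ⨅ p, discTotal M p (posCost M k) α y :=
    fun y => iInf_le (fun x => ⨅ p, discTotal M p (posCost M k) α x) y
  generalize hμ : (⨅ x, ⨅ p, discTotal M p (posCost M k) α x) = μ at *
  have hbell := iInf_le_iInf_discTotal M (measurable_posCost M k) α (g := fun y => G y + μ)
    (fun y => by
      have h := EReal.coe_ennreal_le_coe_ennreal_iff.1 (hG y)
      calc G y + μ ≤ _ := by gcongr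
        _ = _ := tsub_add_cancel_of_le (hle y)) x
  have hF : (⨅ b, stepValue M k γ G (x, b)) + α * μ
      ≤ ((⨅ p, discTotal M p (posCost M k) α x) - μ) + μ := by
    rw [tsub_add_cancel_of_le (hle x)]
    refine le_trans ?_ hbell
    rw [ENNReal.iInf_add]
    refine iInf_mono fun b => ?_
    have := M.markov
    rw [lintegral_add_right _ measurable_const, lintegral_const, measure_univ, mul_one, mul_add,
      ← add_assoc, stepValue]
    gcongr
  generalize (⨅ p, discTotal M p (posCost M k) α x) - μ = D at *
  generalize (⨅ b, stepValue M k γ G (x, b)) = F at *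
  lift μ to ℝ≥0 using hfin
  have hα' : (0 : ℝ) < 1 - α := by simpa using hα
  have hm : ((1 - α : ℝ) : EReal) * (((μ : ℝ≥0∞) : EReal) - (((k : ℝ) / (1 - α) : ℝ) : EReal))
      + ((k : ℝ) : EReal) = (((1 - α) * μ : ℝ) : EReal) := by
    change ((1 - α : ℝ) : EReal) * (((μ : ℝ) : EReal) - (((k : ℝ) / (1 - α) : ℝ) : EReal))
      + ((k : ℝ) : EReal) = _
    rw [← EReal.coe_sub, ← EReal.coe_mul, ← EReal.coe_add]
    congr 1
    field_simp
    ring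
  rw [hm]
  induction D with
  | top => rw [EReal.coe_ennreal_top, EReal.coe_add_top]; exact le_top
  | coe D =>
    have hFt : F ≠ ⊤ := by
      rintro rfl
      simp [← ENNReal.coe_add] at hF
    lift F to ℝ≥0 using hFt
    have hF' : F + α * μ ≤ D + μ := by exact_mod_cast hF
    have hF'' : (F : ℝ) + α * μ ≤ D + μ := by exact_mod_cast hF'
    change ((F : ℝ) : EReal) ≤ (((1 - α) * μ : ℝ) : EReal) + ((D : ℝ) : EReal)
    rw [← EReal.coe_add, EReal.coe_le_coe_iff]
    linarith

section Topological

variable [MetricSpace X] [MetricSpace A]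

lemma infCompact_posCost (hW : AssumptionWi M) (k : ℝ≥0) (K : Set X) (hK : IsCompact K) (r : ℝ≥0) :
    IsCompact {p : X × A | p.1 ∈ K ∧ posCost M k p ≤ r} := by
  rcases K.eq_empty_or_nonempty with rfl | hne
  · simp
  convert hW K hne hK (r - k) using 4 with p
  rw [posCost, ← EReal.coe_ennreal_le_coe_ennreal_iff, EReal.coe_toENNReal_eq_max, max_le_iff,
    and_iff_right (EReal.coe_ennreal_nonneg _), EReal.coe_sub,
    EReal.le_sub_iff_add_le (Or.inl (EReal.coe_ne_bot _)) (Or.inl (EReal.coe_ne_top _))]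
  rfl

lemma infCompact_stepValue [BorelSpace X] (hW1 : AssumptionWi M) (hW2 : AssumptionWii M) (k α : ℝ≥0)
    {G : X → ℝ≥0∞} (hG : LowerSemicontinuous G) (K : Set X) (hK : IsCompact K) (r : ℝ≥0) :
    IsCompact {p : X × A | p.1 ∈ K ∧ stepValue M k α G p ≤ r} := by
  have := M.markov
  refine infCompact_add (infCompact_posCost hW1 k) ?_ K hK r
  exact (ENNReal.continuous_const_mul ENNReal.coe_ne_top).comp_lowerSemicontinuous
    (lowerSemicontinuous_lintegral_of_weak (fun s => M.q s) hW2 hG)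
    fun _ _ h => mul_le_mul_right h _

end Topological

/-- Passing to the lower limit in a lower bound for a sequence of functions by a lower
semicontinuous one. -/
lemma coe_sub_le_liminf_prod {Y : Type*} [TopologicalSpace Y] {F : Y → ℝ≥0∞}
    (hF : LowerSemicontinuous F) {u : ℕ → Y → EReal} {w : ℝ} {m : ℕ}
    (h : ∀ n, m ≤ n → ∀ y, (F y : EReal) ≤ (w : EReal) + u n y) (x : Y) :
    (F x : EReal) - (w : EReal) ≤ liminf (fun p : ℕ × Y => u p.1 p.2) (atTop ×ˢ 𝓝 x) := by
  refine le_of_forall_lt fun r hr => ?_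
  obtain ⟨z, hrz, hz⟩ := exists_between hr
  refine hrz.trans_le (le_liminf_of_le (h := ?_))
  rw [EReal.lt_sub_iff_add_lt (Or.inl (EReal.coe_ne_bot _)) (Or.inl (EReal.coe_ne_top _))] at hz
  have hFE : LowerSemicontinuous fun y => (F y : EReal) :=
    continuous_coe_ennreal_ereal.comp_lowerSemicontinuous hF EReal.coe_ennreal_strictMono.monotone
  filter_upwards [(eventually_ge_atTop m).prod_mk (hFE x _ hz)] with p hp
  have := hp.2.le.trans (h p.1 hp.1 p.2)
  rw [← EReal.le_sub_iff_add_le (Or.inl (EReal.coe_ne_bot _)) (Or.inl (EReal.coe_ne_top _)),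
    add_comm, EReal.add_sub_cancel_right] at this
  exact this

end AverageCostInequality

/-- Under Assumptions W* and B̲_{{α_n}}, with
`U_m(x) := inf_{n≥m} u_{α_n}(x)`, `u̲_m(x) := liminf_{y→x} U_m(y)`, and
`u(x) := liminf_{n→∞, y→x} u_{α_n}(y)`, for every `ε > 0` there exists `n₀ ∈ ℕ` such
that for all `m ≥ n₀` and all `x ∈ X`:
`w̄_{{α_n}} + ε + u(x) ≥ inf_{a∈A} [c(x,a) + α_m ∫ u̲_m dq(·|x,a)]`, and the infimum over
`a ∈ A` is attained. -/
theorem statement14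
    (M : MDP X A)
    (hW1 : AssumptionWi M) (hW2 : AssumptionWii M)
    (a : ℕ → ℝ)
    (ha : ∀ n, a n ∈ Set.Ico (0 : ℝ) 1) (hamono : Monotone a)
    (hatend : Tendsto a atTop (𝓝 (1 : ℝ)))
    (hB1 : wStar M < ⊤)
    (hB2 : ∀ x, Filter.liminf (fun n => uDisc M (a n) x) atTop < ⊤) :
    ∀ ε : ℝ, 0 < ε → ∃ n₀ : ℕ, ∀ m : ℕ, n₀ ≤ m → ∀ x : X,
      (⨅ b : A, (M.c x b + ((a m : ℝ) : EReal) * eInt (M.q (x, b)) (uLowSeq M a m)))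
          ≤ wBarSeq M a + (ε : EReal) + uEqnOne M a x
      ∧ ∃ b₀ : A,
          M.c x b₀ + ((a m : ℝ) : EReal) * eInt (M.q (x, b₀)) (uLowSeq M a m)
            = ⨅ b : A, (M.c x b + ((a m : ℝ) : EReal) * eInt (M.q (x, b)) (uLowSeq M a m)) := by
  intro ε hε
  obtain ⟨K, hK⟩ := M.c_ne_bot
  obtain ⟨k, hk⟩ : ∃ k : ℝ≥0, ∀ x b, ((-(k : ℝ) : ℝ) : EReal) ≤ M.c x b :=
    ⟨(-K).toNNReal, fun x b => (EReal.coe_le_coe_iff.2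
      (neg_le.1 (Real.le_coe_toNNReal (-K)))).trans (hK x b)⟩
  obtain ⟨α, rfl⟩ : ∃ α : ℕ → ℝ≥0, a = fun n => (α n : ℝ) := ⟨fun n => ⟨a n, (ha n).1⟩, rfl⟩
  have hα : ∀ n, α n < 1 := fun n => by exact_mod_cast (ha n).2
  have hαmono : Monotone α := fun i j hij => by exact_mod_cast hamono hij
  have hfin : ∀ n, _ := fun n => iInf_discTotal_ne_top hk hB1 (hα n)
  have hu0 : ∀ n y, 0 ≤ uDisc M (α n) y := fun n y => by
    rw [uDisc_eq hk (hα n) (hfin n)]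
    exact EReal.coe_ennreal_nonneg _
  have hL0 : ∀ m y, 0 ≤ uLowSeq M (fun n => (α n : ℝ)) m y := fun m y =>
    le_liminf_of_le (h := Eventually.of_forall fun z => le_iInf₂ fun n _ => hu0 n z)
  have hLle : ∀ m n, m ≤ n → ∀ y, uLowSeq M (fun n => (α n : ℝ)) m y ≤ uDisc M (α n) y :=
    fun m n hmn y => (liminf_nhds_le _ y).trans (iInf₂_le n hmn)
  have hG : ∀ m, LowerSemicontinuous fun y => (uLowSeq M (fun n => (α n : ℝ)) m y).toENNReal :=
    fun m => EReal.continuous_toENNReal.comp_lowerSemicontinuous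
      (lowerSemicontinuous_liminf_nhds _) fun _ _ h => EReal.toENNReal_le_toENNReal h
  have hA : Nonempty A := by
    obtain ⟨x, hx⟩ := iInf_lt_iff.1 hB1
    obtain ⟨p, -⟩ := iInf_lt_iff.1 hx
    have := p.markov 0
    exact (p.π 0 (Fin.elim0, x)).nonempty_of_neZero
  have hF : ∀ m, ∀ S : Set X, IsCompact S → ∀ r : ℝ≥0, IsCompact {p : X × A | p.1 ∈ S ∧
      stepValue M k (α m) (fun y => (uLowSeq M (fun n => (α n : ℝ)) m y).toENNReal) p ≤ r} :=
    fun m => infCompact_stepValue hW1 hW2 k (α m) (hG m)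
  have hinf : ∀ m x, ⨅ b : A, (M.c x b + ((α m : ℝ) : EReal) *
      eInt (M.q (x, b)) (uLowSeq M (fun n => (α n : ℝ)) m))
      = ((⨅ b, stepValue M k (α m) (fun y => (uLowSeq M (fun n => (α n : ℝ)) m y).toENNReal)
        (x, b) : ℝ≥0∞) : EReal) - ((k : ℝ) : EReal) := fun m x => by
    simp_rw [add_mul_eInt_eq_stepValue hk (α m) (hL0 m)]
    exact iInf_coe_ennreal_sub _ _
  obtain ⟨n₀, hn₀⟩ : ∃ n₀, ∀ m, n₀ ≤ m → ∀ x,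
      ((⨅ b, stepValue M k (α m) (fun y => (uLowSeq M (fun n => (α n : ℝ)) m y).toENNReal)
        (x, b) : ℝ≥0∞) : EReal) - ((k : ℝ) : EReal)
      ≤ wBarSeq M (fun n => (α n : ℝ)) + (ε : EReal) + uEqnOne M (fun n => (α n : ℝ)) x := by
    have hU0 : ∀ x, 0 ≤ uEqnOne M (fun n => (α n : ℝ)) x := fun x =>
      le_liminf_of_le (h := Eventually.of_forall fun z => hu0 _ _)
    have hWbot : wBarSeq M (fun n => (α n : ℝ)) ≠ ⊥ := by
      refine ne_bot_of_le_ne_bot (EReal.coe_ne_bot (-(k : ℝ))) (le_limsup_of_frequently_le'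
        (Frequently.of_forall fun n => neg_le_mul_mDisc hk hB1 (hα n)))
    induction hW : wBarSeq M (fun n => (α n : ℝ)) with
    | bot => exact absurd hW hWbot
    | top =>
      refine ⟨0, fun m _ x => ?_⟩
      rw [EReal.top_add_coe, EReal.top_add_of_ne_bot (ne_bot_of_le_ne_bot EReal.zero_ne_bot (hU0 x))]
      exact le_top
    | coe W =>
      have hlt : wBarSeq M (fun n => (α n : ℝ)) < ((W + ε : ℝ) : EReal) := by
        rw [hW, EReal.coe_lt_coe_iff]
        linarith
      obtain ⟨n₀, hn₀⟩ := eventually_atTop.1 (eventually_lt_of_limsup_lt hlt)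
      refine ⟨n₀, fun m hm x => ?_⟩
      have key := coe_sub_le_liminf_prod (lowerSemicontinuous_iInf_of_infCompact (hF m))
        (u := fun n y => uDisc M (α n) y) (w := W + ε + k) (m := m) (fun n hn y => by
          refine (iInf_stepValue_le hk hB1 (hαmono hn) (hα n) (fun z => ?_) y).trans ?_
          · rw [EReal.coe_toENNReal (hL0 m z)]
            exact hLle m n hn z
          · rw [EReal.coe_add (W + ε)]
            gcongr
            exact (hn₀ n (hm.trans hn)).le) x
      rw [EReal.sub_le_iff_le_add (Or.inl (EReal.coe_ne_bot _)) (Or.inl (EReal.coe_ne_top _))]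
        at key ⊢
      refine key.trans_eq ?_
      rw [uEqnOne, EReal.coe_add, EReal.coe_add, ← add_assoc, add_comm (liminf _ _)]
  refine ⟨n₀, fun m hm x => ⟨(hinf m x).trans_le (hn₀ m hm x), ?_⟩⟩
  obtain ⟨b, hb⟩ := exists_eq_iInf_of_infCompact (hF m) x
  exact ⟨b, by rw [hinf, ← hb]; exact add_mul_eInt_eq_stepValue hk (α m) (hL0 m) x b⟩

end Statements

end
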